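/- Let (G,q) be a framework in Σ and let S = {q_v : v ∈ V}. Then (G,q) is full in Σ if and only if π(S) contains two linearly independent vectors. -/

import Mathlib

open Matrix

/-- The hypercylinder Σ in ℝ⁴. -/
def Hyp : Set (Fin 4 → ℝ) := {x | x 0 ^ 2 + x 1 ^ 2 + x 2 ^ 2 = 1}

/-- π(x)·π(y), where π : ℝ⁴ → ℝ³ drops the last coordinate. -/
def piDot (x y : Fin 4 → ℝ) : ℝ := x 0 * y 0 + x 1 * y 1 + x 2 * y 2

/-- The pair (B,c), with B a 4×4 skew-symmetric matrix and c ∈ ℝ⁴, determines an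
infinitesimal rigid motion η(x) = Bx + c of the hypercylinder Σ (an element of T(Σ))
if π(η(x))·π(x) = 0 for all x ∈ Σ. -/
def InTSigma (B : Matrix (Fin 4) (Fin 4) ℝ) (c : Fin 4 → ℝ) : Prop :=
  Bᵀ = -B ∧ ∀ x ∈ Hyp, piDot (B.mulVec x + c) x = 0

/-- The projection π : ℝ⁴ → ℝ³. -/
def piProj (x : Fin 4 → ℝ) : Fin 3 → ℝ := ![x 0, x 1, x 2]

/-- The matrix of `x ↦ p × π(x)`, viewed as an endomorphism of ℝ⁴ with zero last coordinate. -/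
def crossMatrix (p : Fin 3 → ℝ) : Matrix (Fin 4) (Fin 4) ℝ :=
  !![0, -p 2, p 1, 0; p 2, 0, -p 0, 0; -p 1, p 0, 0, 0; 0, 0, 0, 0]

theorem crossMatrix_mulVec (p : Fin 3 → ℝ) (x : Fin 4 → ℝ) :
    crossMatrix p *ᵥ x =
      ![(p ⨯₃ piProj x) 0, (p ⨯₃ piProj x) 1, (p ⨯₃ piProj x) 2, 0] := by
  ext i
  fin_cases i <;>
    simp [crossMatrix, piProj, Matrix.mulVec, dotProduct, Fin.sum_univ_four, cross_apply] <;> ring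

theorem crossMatrix_mulVec_eq_zero {p : Fin 3 → ℝ} {x : Fin 4 → ℝ} :
    crossMatrix p *ᵥ x = 0 ↔ p ⨯₃ piProj x = 0 := by
  rw [crossMatrix_mulVec]
  simp [funext_iff, Fin.forall_fin_succ]

theorem crossMatrix_eq_zero {p : Fin 3 → ℝ} : crossMatrix p = 0 ↔ p = 0 := by
  constructor
  · intro h
    ext i
    fin_cases i
    · simpa [crossMatrix] using congrFun₂ h 2 1
    · simpa [crossMatrix] using congrFun₂ h 0 2
    · simpa [crossMatrix] using congrFun₂ h 1 0
  · rintro rfl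
    ext i j
    fin_cases i <;> fin_cases j <;> simp [crossMatrix]

theorem inTSigma_crossMatrix (p : Fin 3 → ℝ) : InTSigma (crossMatrix p) 0 := by
  constructor
  · ext i j
    fin_cases i <;> fin_cases j <;> simp [crossMatrix]
  · intro x _
    simp [crossMatrix_mulVec, piDot, piProj, cross_apply]
    ring

/-- Every infinitesimal rigid motion of Σ is a rotation about the axis of the cylinder
followed by a translation along it. -/
theorem InTSigma.exists_eq {B : Matrix (Fin 4) (Fin 4) ℝ} {c : Fin 4 → ℝ} (h : InTSigma B c) :
    ∃ p t, B = crossMatrix p ∧ c = ![0, 0, 0, t] := by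
  obtain ⟨hB, hx⟩ := h
  have skew (i j : Fin 4) : B j i = -B i j := congrFun₂ hB i j
  have diag (i : Fin 4) : B i i = 0 := by linarith [skew i i]
  have a0 := hx ![1, 0, 0, 0] (by simp [Hyp])
  have a1 := hx ![0, 1, 0, 0] (by simp [Hyp])
  have a2 := hx ![0, 0, 1, 0] (by simp [Hyp])
  have b0 := hx ![1, 0, 0, 1] (by simp [Hyp])
  have b1 := hx ![0, 1, 0, 1] (by simp [Hyp])
  have b2 := hx ![0, 0, 1, 1] (by simp [Hyp])
  simp [piDot, Matrix.mulVec, dotProduct, Fin.sum_univ_four, diag] at a0 a1 a2 b0 b1 b2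
  simp only [a0, a1, a2, add_zero] at b0 b1 b2
  refine ⟨![B 2 1, B 0 2, B 1 0], c 3, ?_, ?_⟩
  · ext i j
    fin_cases i <;> fin_cases j <;>
      simp [crossMatrix, diag, b0, b1, b2, skew 0 3, skew 1 3, skew 2 3, skew 1 0, skew 2 0,
        skew 2 1]
  · ext i
    fin_cases i <;> simp [a0, a1, a2]

/-- A vector parallel to both members of a linearly independent pair vanishes. -/
theorem eq_zero_of_cross_eq_zero {b u w : Fin 3 → ℝ} (huw : u ⨯₃ w ≠ 0)
    (hu : b ⨯₃ u = 0) (hw : b ⨯₃ w = 0) : b = 0 := by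
  by_contra hb
  have key (v : Fin 3 → ℝ) (hv : b ⨯₃ v = 0) : ∃ t : ℝ, t • b = v := by
    by_contra! hne
    exact crossProduct_ne_zero_iff_linearIndependent.2
      ((LinearIndependent.pair_iff' hb).2 hne) hv
  obtain ⟨s, rfl⟩ := key u hu
  obtain ⟨t, rfl⟩ := key w hw
  simp at huw

theorem stmt1 {V : Type*} [Fintype V] (G : SimpleGraph V) (q : V → Fin 4 → ℝ)
    (hq : ∀ v, q v ∈ Hyp) :
    (∀ (B : Matrix (Fin 4) (Fin 4) ℝ) (c : Fin 4 → ℝ), InTSigma B c →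
        (∀ v, B.mulVec (q v) + c = 0) → B = 0 ∧ c = 0) ↔
      (∃ u w : V, LinearIndependent ℝ ![![q u 0, q u 1, q u 2], ![q w 0, q w 1, q w 2]]) := by
  change _ ↔ ∃ u w : V, LinearIndependent ℝ ![piProj (q u), piProj (q w)]
  simp only [← crossProduct_ne_zero_iff_linearIndependent]
  constructor
  · intro h
    by_contra! hcross
    obtain ⟨p, hp, hpq⟩ : ∃ p : Fin 3 → ℝ, p ≠ 0 ∧ ∀ v, p ⨯₃ piProj (q v) = 0 := by
      cases isEmpty_or_nonempty V with
      | inl _ => exact ⟨1, one_ne_zero, isEmptyElim⟩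
      | inr hV =>
        obtain ⟨u⟩ := hV
        refine ⟨piProj (q u), fun h0 => ?_, hcross u⟩
        have hu := hq u
        simp [piProj] at h0
        simp [Hyp, h0] at hu
    refine hp (crossMatrix_eq_zero.1 (h _ 0 (inTSigma_crossMatrix p) fun v => ?_).1)
    rw [add_zero, crossMatrix_mulVec_eq_zero, hpq]
  · rintro ⟨u, w, huw⟩ B c hBc hzero
    obtain ⟨p, t, rfl, rfl⟩ := hBc.exists_eq
    have ht : t = 0 := by simpa [crossMatrix_mulVec] using congrFun (hzero u) 3
    have hc : (![0, 0, 0, t] : Fin 4 → ℝ) = 0 := by simp [ht]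
    simp only [hc, add_zero, crossMatrix_mulVec_eq_zero] at hzero
    exact ⟨crossMatrix_eq_zero.2 (eq_zero_of_cross_eq_zero huw (hzero u) (hzero w)), hc⟩
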